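/- Let A and B be finite-dimensional Lie algebras over a field k. Then dim M⁽²⁾(A ⊕ B) = dim M⁽²⁾(A) + dim M⁽²⁾(B) + (dim A/A²)²·(dim B/B²) + (dim B/B²)²·(dim A/A²), where A² = [A,A] and B² = [B,B]. -/

import Mathlib

open Module

universe u

section Preliminaries

variable (k : Type u) [Field k]

/-- The product of two Lie rings is a Lie ring with componentwise bracket. -/
instance prodLieRing (A B : Type u) [LieRing A] [LieRing B] : LieRing (A × B) where
  bracket x y := (⁅x.1, y.1⁆, ⁅x.2, y.2⁆)
  add_lie x y z := by ext <;> exact add_lie ..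
  lie_add x y z := by ext <;> exact lie_add ..
  lie_self x := by ext <;> exact lie_self _
  leibniz_lie x y z := by ext <;> exact leibniz_lie ..

/-- The product of two Lie algebras (the external direct sum `A ⊕ B`). -/
instance prodLieAlgebra (A B : Type u) [LieRing A] [LieRing B]
    [LieAlgebra k A] [LieAlgebra k B] : LieAlgebra k (A × B) where
  lie_smul t x y := by ext <;> exact lie_smul ..

/-- `L` is a Heisenberg Lie algebra `H(m)`: it has dimension `2m+1` and its derived
subalgebra `L² = [L,L]` coincides with its centre `Z(L)` and has dimension `1`. -/
def IsHeisenberg (L : Type u) [LieRing L] [LieAlgebra k L] (m : ℕ) : Prop :=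
  Module.finrank k L = 2 * m + 1 ∧
  LieModule.lowerCentralSeries k L L 1 = LieAlgebra.center k L ∧
  Module.finrank k (LieAlgebra.center k L) = 1

/-- The `k`-dimension of the quotient `A / (A ∩ B)` of a submodule `A` by a submodule `B`
(when `B ≤ A` this is the dimension of `A/B`). -/
noncomputable def subQuotRank {V : Type u} [AddCommGroup V] [Module k V]
    (A B : Submodule k V) : Cardinal.{u} :=
  Module.rank k (↥A ⧸ B.comap A.subtype)

/-- The dimension of the 2-nilpotent multiplier `M⁽²⁾(L) = (R ∩ F³)/[[R,F],F]` computed from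
the free presentation `π : F ↠ L` (with `F` a free Lie algebra and `R = ker π`). -/
noncomputable def m2Rank {X L : Type u} [LieRing L] [LieAlgebra k L]
    (π : FreeLieAlgebra k X →ₗ⁅k⁆ L) : Cardinal.{u} :=
  subQuotRank k
    (π.ker ⊓ LieModule.lowerCentralSeries k (FreeLieAlgebra k X) (FreeLieAlgebra k X) 2).toSubmodule
    (⁅(⁅π.ker, (⊤ : LieIdeal k (FreeLieAlgebra k X))⁆ : LieIdeal k (FreeLieAlgebra k X)),
      (⊤ : LieIdeal k (FreeLieAlgebra k X))⁆ : LieIdeal k (FreeLieAlgebra k X)).toSubmodule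

/-- A Lie algebra is 2-capable if it is isomorphic to `H/Z₂(H)` for some Lie algebra `H`,
where `Z₂(H)` is the second term of the upper central series of `H`. -/
def TwoCapable (L : Type u) [LieRing L] [LieAlgebra k L] : Prop :=
  ∃ (H : Type u) (_ : LieRing H) (_ : LieAlgebra k H),
    Nonempty (L ≃ₗ⁅k⁆ H ⧸ LieSubmodule.ucs 2 (⊥ : LieIdeal k H))

/-- A Lie algebra is capable if it is isomorphic to `H/Z(H)` for some Lie algebra `H`. -/
def Capable (L : Type u) [LieRing L] [LieAlgebra k L] : Prop :=
  ∃ (H : Type u) (_ : LieRing H) (_ : LieAlgebra k H),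
    Nonempty (L ≃ₗ⁅k⁆ H ⧸ LieAlgebra.center k H)

end Preliminaries

section Helpers

variable {k : Type u} [Field k]

theorem tri_le {F : Type u} [LieRing F] [LieAlgebra k F] (I J K : LieIdeal k F)
    (S : Submodule k F) (h : ∀ x ∈ I, ∀ y ∈ J, ∀ z ∈ K, ⁅⁅x, y⁆, z⁆ ∈ S) :
    ∀ t ∈ (⁅(⁅I, J⁆ : LieIdeal k F), K⁆ : LieIdeal k F), t ∈ S := by
  intro t ht
  rw [← LieSubmodule.mem_toSubmodule, LieSubmodule.lieIdeal_oper_eq_linear_span'] at ht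
  refine Submodule.span_le.mpr ?_ ht
  rintro _ ⟨m, hm, z, hz, rfl⟩
  rw [← LieSubmodule.mem_toSubmodule, LieSubmodule.lieIdeal_oper_eq_linear_span'] at hm
  refine Submodule.span_induction (p := fun m _ => ⁅m, z⁆ ∈ S) ?_ ?_ ?_ ?_ hm
  · rintro _ ⟨x, hx, y, hy, rfl⟩
    exact h x hx y hy z hz
  · simp
  · intro a b _ _ ha hb
    rw [add_lie]; exact S.add_mem ha hb
  · intro c a _ ha
    rw [smul_lie]; exact S.smul_mem c ha

/-- `[[I,F],F]`. -/
def gI {F : Type u} [LieRing F] [LieAlgebra k F] (I : LieIdeal k F) : LieIdeal k F :=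
  ⁅(⁅I, (⊤ : LieIdeal k F)⁆ : LieIdeal k F), (⊤ : LieIdeal k F)⁆

section
variable {F : Type u} [LieRing F] [LieAlgebra k F]

theorem gI_12 {I : LieIdeal k F} {x z : F} (hx : x ∈ (⁅I, (⊤ : LieIdeal k F)⁆ : LieIdeal k F)) :
    ⁅x, z⁆ ∈ gI I := LieSubmodule.lie_mem_lie hx (LieSubmodule.mem_top z)

theorem gI_b1 {I : LieIdeal k F} {x : F} (y : F) (hx : x ∈ I) :
    ⁅x, y⁆ ∈ (⁅I, (⊤ : LieIdeal k F)⁆ : LieIdeal k F) :=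
  LieSubmodule.lie_mem_lie hx (LieSubmodule.mem_top y)

theorem gI_b2 {I : LieIdeal k F} {x : F} (y : F) (hx : x ∈ I) :
    ⁅y, x⁆ ∈ (⁅I, (⊤ : LieIdeal k F)⁆ : LieIdeal k F) := by
  rw [← lie_skew]; exact neg_mem (gI_b1 y hx)

theorem gI_1 {I : LieIdeal k F} {x : F} (y z : F) (hx : x ∈ I) : ⁅⁅x, y⁆, z⁆ ∈ gI I :=
  gI_12 (gI_b1 y hx)

theorem gI_2 {I : LieIdeal k F} {x : F} (y z : F) (hx : x ∈ I) : ⁅⁅y, x⁆, z⁆ ∈ gI I :=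
  gI_12 (gI_b2 y hx)

theorem gI_r {I : LieIdeal k F} {x : F} (y z : F) (hx : x ∈ I) : ⁅x, ⁅y, z⁆⁆ ∈ gI I := by
  rw [leibniz_lie, ← lie_skew y]
  exact add_mem (gI_1 y z hx) (neg_mem (gI_1 z y hx))

theorem gI_3 {I : LieIdeal k F} {x : F} (y z : F) (hx : x ∈ I) : ⁅⁅y, z⁆, x⁆ ∈ gI I := by
  rw [← lie_skew]; exact neg_mem (gI_r y z hx)

theorem gI_le (I : LieIdeal k F) : gI I ≤ I := by
  intro t ht
  exact tri_le I ⊤ ⊤ I.toSubmodule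
    (fun x hx y _ z _ => lie_mem_left k F I _ _ (lie_mem_left k F I _ _ hx)) t ht

theorem lcs_two_eq : LieModule.lowerCentralSeries k F F 2 = gI (⊤ : LieIdeal k F) := by
  rw [LieModule.lowerCentralSeries_succ, LieModule.lowerCentralSeries_succ,
    LieModule.lowerCentralSeries_zero, gI]
  exact LieSubmodule.lie_comm _ _

theorem lcs_one_eq : LieModule.lowerCentralSeries k F F 1 =
    (⁅(⊤ : LieIdeal k F), (⊤ : LieIdeal k F)⁆ : LieIdeal k F) := by
  rw [LieModule.lowerCentralSeries_succ, LieModule.lowerCentralSeries_zero]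

theorem gI_mono {I J : LieIdeal k F} (h : I ≤ J) : gI I ≤ gI J := by
  intro t ht
  exact tri_le I ⊤ ⊤ (gI J).toSubmodule (fun x hx y _ z _ => gI_1 y z (h hx)) t ht
end

section
variable {F F' : Type u} [LieRing F] [LieAlgebra k F] [LieRing F'] [LieAlgebra k F']

theorem map_gI (φ : F →ₗ⁅k⁆ F') (I : LieIdeal k F) (J : LieIdeal k F')
    (h : ∀ x ∈ I, φ x ∈ J) : ∀ t ∈ gI I, φ t ∈ gI J := by
  refine tri_le I ⊤ ⊤ ((gI J).toSubmodule.comap (φ : F →ₗ[k] F')) ?_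
  intro x hx y _ z _
  change φ ⁅⁅x, y⁆, z⁆ ∈ gI J
  rw [LieHom.map_lie, LieHom.map_lie]
  exact gI_1 _ _ (h x hx)

theorem diff_gI (φ ψ : F →ₗ⁅k⁆ F') (I : LieIdeal k F) (J : LieIdeal k F')
    (h : ∀ x ∈ I, φ x - ψ x ∈ J) :
    ∀ t ∈ (⁅(⁅I, I⁆ : LieIdeal k F), I⁆ : LieIdeal k F), φ t - ψ t ∈ gI J := by
  refine tri_le I I I ((gI J).toSubmodule.comap ((φ : F →ₗ[k] F') - (ψ : F →ₗ[k] F'))) ?_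
  intro x hx y hy z hz
  change φ ⁅⁅x, y⁆, z⁆ - ψ ⁅⁅x, y⁆, z⁆ ∈ gI J
  simp only [LieHom.map_lie]
  have e : ⁅⁅φ x, φ y⁆, φ z⁆ - ⁅⁅ψ x, ψ y⁆, ψ z⁆ = ⁅⁅φ x - ψ x, φ y⁆, φ z⁆
      + ⁅⁅ψ x, φ y - ψ y⁆, φ z⁆ + ⁅⁅ψ x, ψ y⁆, φ z - ψ z⁆ := by
    simp only [sub_lie, lie_sub]; abel
  rw [e]
  exact add_mem (add_mem (gI_1 _ _ (h x hx)) (gI_2 _ _ (h y hy))) (gI_3 _ _ (h z hz))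
end

theorem exists_lift {X L F' : Type u} [LieRing L] [LieAlgebra k L] [LieRing F'] [LieAlgebra k F']
    (π : FreeLieAlgebra k X →ₗ⁅k⁆ L) (π' : F' →ₗ⁅k⁆ L) (h : Function.Surjective π') :
    ∃ φ : FreeLieAlgebra k X →ₗ⁅k⁆ F', ∀ x, π' (φ x) = π x := by
  choose s hs using h
  refine ⟨FreeLieAlgebra.lift k (fun x => s (π (FreeLieAlgebra.of k x))), fun x => ?_⟩
  have : π'.comp (FreeLieAlgebra.lift k (fun x => s (π (FreeLieAlgebra.of k x)))) = π := by
    apply FreeLieAlgebra.hom_ext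
    intro x
    simp [hs]
  exact LieHom.congr_fun this x

theorem subQuotRank_le {V V' : Type u} [AddCommGroup V] [Module k V] [AddCommGroup V']
    [Module k V'] (A B : Submodule k V) (A' B' : Submodule k V') (φ : V →ₗ[k] V')
    (h1 : ∀ x ∈ A, φ x ∈ A') (h2 : ∀ x ∈ A, x ∈ B ↔ φ x ∈ B') :
    subQuotRank k A B ≤ subQuotRank k A' B' := by
  unfold subQuotRank
  let f : A →ₗ[k] A' := φ.restrict h1
  have hle : B.comap A.subtype ≤ (B'.comap A'.subtype).comap f := by
    intro x hx
    exact (h2 x x.2).1 hx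
  refine LinearMap.rank_le_of_injective (Submodule.mapQ _ _ f hle) ?_
  rw [← LinearMap.ker_eq_bot, LinearMap.ker_eq_bot']
  intro m hm
  induction m using Submodule.Quotient.induction_on with
  | H a =>
  rw [Submodule.mapQ_apply, Submodule.Quotient.mk_eq_zero] at hm
  rw [Submodule.Quotient.mk_eq_zero]
  exact (h2 a a.2).2 hm

theorem m2Rank_eq {X L : Type u} [LieRing L] [LieAlgebra k L]
    (π : FreeLieAlgebra k X →ₗ⁅k⁆ L) :
    m2Rank k π = subQuotRank k (π.ker ⊓ gI ⊤).toSubmodule (gI π.ker).toSubmodule := by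
  rw [m2Rank, lcs_two_eq]; rfl

theorem m2Rank_le {X X' L : Type u} [LieRing L] [LieAlgebra k L]
    (π : FreeLieAlgebra k X →ₗ⁅k⁆ L) (h : Function.Surjective π)
    (π' : FreeLieAlgebra k X' →ₗ⁅k⁆ L) (h' : Function.Surjective π') :
    m2Rank k π ≤ m2Rank k π' := by
  obtain ⟨φ, hφ⟩ := exists_lift π π' h'
  obtain ⟨ψ, hψ⟩ := exists_lift π' π h
  rw [m2Rank_eq, m2Rank_eq]
  have k1 : ∀ x ∈ π.ker, φ x ∈ π'.ker := fun x hx => by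
    rw [LieHom.mem_ker] at *; rw [hφ, hx]
  have k2 : ∀ x ∈ π'.ker, ψ x ∈ π.ker := fun x hx => by
    rw [LieHom.mem_ker] at *; rw [hψ, hx]
  refine subQuotRank_le _ _ _ _ (φ : FreeLieAlgebra k X →ₗ[k] FreeLieAlgebra k X') ?_ ?_
  · rintro x ⟨hx1, hx2⟩
    exact ⟨k1 x hx1, map_gI φ ⊤ ⊤ (fun _ _ => LieSubmodule.mem_top _) x hx2⟩
  · rintro x ⟨hx1, hx2⟩
    refine ⟨fun hx => map_gI φ _ _ k1 x hx, fun hx => ?_⟩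
    have e1 : ψ (φ x) ∈ gI π.ker := map_gI ψ _ _ k2 _ hx
    have e2 := diff_gI (ψ.comp φ) (LieHom.id) ⊤ π.ker (fun y _ => by
      rw [LieHom.mem_ker]; simp [hψ, hφ]) x hx2
    have e3 : ψ (φ x) - x ∈ gI π.ker := e2
    have := sub_mem e1 e3
    rw [sub_sub_cancel] at this
    exact this

theorem m2Rank_indep {X X' L : Type u} [LieRing L] [LieAlgebra k L]
    (π : FreeLieAlgebra k X →ₗ⁅k⁆ L) (h : Function.Surjective π)
    (π' : FreeLieAlgebra k X' →ₗ⁅k⁆ L) (h' : Function.Surjective π') :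
    m2Rank k π = m2Rank k π' :=
  le_antisymm (m2Rank_le π h π' h') (m2Rank_le π' h' π h)

theorem free_top {X : Type u} (S : LieSubalgebra k (FreeLieAlgebra k X))
    (h : ∀ x, FreeLieAlgebra.of k x ∈ S) : ∀ x, x ∈ S := by
  intro x
  have : S.incl.comp (FreeLieAlgebra.lift k (fun x => (⟨FreeLieAlgebra.of k x, h x⟩ : S)))
      = LieHom.id := by
    apply FreeLieAlgebra.hom_ext
    intro x
    simp
  have e := LieHom.congr_fun this x
  have e' : ((FreeLieAlgebra.lift k (fun x => (⟨FreeLieAlgebra.of k x, h x⟩ : S)) x : S) :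
    FreeLieAlgebra k X) = x := e
  rw [← e']
  exact SetLike.coe_mem _

theorem exists_triple {X : Type u} (f g h : FreeLieAlgebra k X →ₗ[k] k)
    (hf : ∀ x y : FreeLieAlgebra k X, f ⁅x, y⁆ = 0)
    (hg : ∀ x y : FreeLieAlgebra k X, g ⁅x, y⁆ = 0)
    (hh : ∀ x y : FreeLieAlgebra k X, h ⁅x, y⁆ = 0) :
    ∃ Φ : FreeLieAlgebra k X →ₗ[k] k, ∀ x y z : FreeLieAlgebra k X, Φ ⁅⁅x, y⁆, z⁆ =
      (f x * g y - f y * g x) * h z - f z * (g x * h y - g y * h x) := by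
  let iR : LieRing (Matrix (Fin 4) (Fin 4) k) := LieRing.ofAssociativeRing
  let iA : LieAlgebra k (Matrix (Fin 4) (Fin 4) k) := LieAlgebra.ofAssociativeAlgebra
  let ρ : FreeLieAlgebra k X →ₗ⁅k⁆ Matrix (Fin 4) (Fin 4) k :=
    FreeLieAlgebra.lift k (fun x =>
      !![0, f (FreeLieAlgebra.of k x), 0, 0; 0, 0, g (FreeLieAlgebra.of k x), 0;
        0, 0, 0, h (FreeLieAlgebra.of k x); 0, 0, 0, 0])
  let S : LieSubalgebra k (FreeLieAlgebra k X) :=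
    { carrier := {x | (∀ i j, j ≤ i → ρ x i j = 0) ∧ ρ x 0 1 = f x ∧ ρ x 1 2 = g x ∧ ρ x 2 3 = h x}
      add_mem' := by
        rintro a b ⟨a1, a2, a3, a4⟩ ⟨b1, b2, b3, b4⟩
        refine ⟨fun i j hij => ?_, ?_, ?_, ?_⟩
        · simp [a1 i j hij, b1 i j hij]
        · simp [a2, b2]
        · simp [a3, b3]
        · simp [a4, b4]
      zero_mem' := by simp
      smul_mem' := by
        rintro c a ⟨a1, a2, a3, a4⟩
        refine ⟨fun i j hij => ?_, ?_, ?_, ?_⟩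
        · simp [a1 i j hij]
        · simp [a2]
        · simp [a3]
        · simp [a4]
      lie_mem' := by
        rintro a b ⟨a1, a2, a3, a4⟩ ⟨b1, b2, b3, b4⟩
        refine ⟨fun i j hij => ?_, ?_, ?_, ?_⟩
        · rw [LieHom.map_lie, LieRing.of_associative_ring_bracket, Matrix.sub_apply,
            Matrix.mul_apply, Matrix.mul_apply, Finset.sum_eq_zero, Finset.sum_eq_zero, sub_zero]
          · intro l _
            rcases le_total l i with hl | hl
            · rw [b1 i l hl, zero_mul]
            · rw [a1 l j (hij.trans hl), mul_zero]
          · intro l _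
            rcases le_total l i with hl | hl
            · rw [a1 i l hl, zero_mul]
            · rw [b1 l j (hij.trans hl), mul_zero]
        all_goals
          rw [LieHom.map_lie, LieRing.of_associative_ring_bracket, Matrix.sub_apply,
            Matrix.mul_apply, Matrix.mul_apply, Fin.sum_univ_four, Fin.sum_univ_four]
        · rw [hf, a1 0 0 (by decide), a1 1 1 (by decide), a1 2 1 (by decide), a1 3 1 (by decide),
            b1 0 0 (by decide), b1 1 1 (by decide), b1 2 1 (by decide), b1 3 1 (by decide)]
          ring
        · rw [hg, a1 1 0 (by decide), a1 1 1 (by decide), a1 2 2 (by decide), a1 3 2 (by decide),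
            b1 1 0 (by decide), b1 1 1 (by decide), b1 2 2 (by decide), b1 3 2 (by decide)]
          ring
        · rw [hh, a1 2 0 (by decide), a1 2 1 (by decide), a1 2 2 (by decide), a1 3 3 (by decide),
            b1 2 0 (by decide), b1 2 1 (by decide), b1 2 2 (by decide), b1 3 3 (by decide)]
          ring }
  have hS : ∀ x, x ∈ S := by
    apply free_top
    intro x
    refine ⟨fun i j hij => ?_, ?_, ?_, ?_⟩
    · fin_cases i <;> fin_cases j <;> first | (exfalso; revert hij; decide) | simp [ρ]
    all_goals simp [ρ]
  refine ⟨⟨⟨fun x => ρ x 0 3, fun x y => by simp⟩, fun c x => by simp⟩, fun x y z => ?_⟩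
  change ρ ⁅⁅x, y⁆, z⁆ 0 3 = _
  obtain ⟨x1, x2, x3, x4⟩ := hS x
  obtain ⟨y1, y2, y3, y4⟩ := hS y
  obtain ⟨z1, z2, z3, z4⟩ := hS z
  obtain ⟨w1, w2, w3, w4⟩ := hS ⁅x, y⁆
  rw [hf] at w2
  rw [hh] at w4
  have u1 : ρ ⁅x, y⁆ 0 2 = f x * g y - f y * g x := by
    rw [LieHom.map_lie, LieRing.of_associative_ring_bracket, Matrix.sub_apply,
      Matrix.mul_apply, Matrix.mul_apply, Fin.sum_univ_four, Fin.sum_univ_four,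
      x1 0 0 (by decide), x1 2 2 (by decide), x1 3 2 (by decide),
      y1 0 0 (by decide), y1 2 2 (by decide), y1 3 2 (by decide), x2, y2, x3, y3]
    ring
  have u2 : ρ ⁅x, y⁆ 1 3 = g x * h y - g y * h x := by
    rw [LieHom.map_lie, LieRing.of_associative_ring_bracket, Matrix.sub_apply,
      Matrix.mul_apply, Matrix.mul_apply, Fin.sum_univ_four, Fin.sum_univ_four,
      x1 1 0 (by decide), x1 1 1 (by decide), x1 3 3 (by decide),
      y1 1 0 (by decide), y1 1 1 (by decide), y1 3 3 (by decide), x3, y3, x4, y4]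
    ring
  rw [LieHom.map_lie ρ ⁅x, y⁆ z, LieRing.of_associative_ring_bracket, Matrix.sub_apply,
      Matrix.mul_apply, Matrix.mul_apply, Fin.sum_univ_four, Fin.sum_univ_four,
      w1 0 0 (by decide), w1 3 3 (by decide), w2, w4, u1, u2,
      z1 0 0 (by decide), z1 3 3 (by decide), z2, z4]
  ring

section
variable {F : Type u} [LieRing F] [LieAlgebra k F]

/-- `[[I,J],K]`. -/
def tI (I J K : LieIdeal k F) : LieIdeal k F := ⁅(⁅I, J⁆ : LieIdeal k F), K⁆

theorem mem_tI {I J K : LieIdeal k F} {x y z : F} (hx : x ∈ I) (hy : y ∈ J) (hz : z ∈ K) :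
    ⁅⁅x, y⁆, z⁆ ∈ tI I J K :=
  LieSubmodule.lie_mem_lie (LieSubmodule.lie_mem_lie hx hy) hz

/-- `F³ ≤ [[Q,Q],Q] + [[P,F],F]`. -/
theorem top_le {P Q : LieIdeal k F} (h : ∀ x : F, ∃ p ∈ P, ∃ q ∈ Q, p + q = x) :
    ∀ t ∈ gI (⊤ : LieIdeal k F), t ∈ tI Q Q Q ⊔ gI P := by
  refine tri_le ⊤ ⊤ ⊤ (tI Q Q Q ⊔ gI P).toSubmodule ?_
  intro x _ y _ z _
  obtain ⟨p, hp, q, hq, rfl⟩ := h x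
  obtain ⟨p', hp', q', hq', rfl⟩ := h y
  obtain ⟨p'', hp'', q'', hq'', rfl⟩ := h z
  have e : ⁅⁅p + q, p' + q'⁆, p'' + q''⁆ = ⁅⁅q, q'⁆, q''⁆ + (⁅⁅p, p' + q'⁆, p'' + q''⁆ +
      ⁅⁅q, p'⁆, p'' + q''⁆ + ⁅⁅q, q'⁆, p''⁆) := by
    simp only [add_lie, lie_add]; abel
  rw [e]
  exact add_mem (LieSubmodule.mem_sup_left (mem_tI hq hq' hq''))
    (LieSubmodule.mem_sup_right (add_mem (add_mem (gI_1 _ _ hp) (gI_2 _ _ hp')) (gI_3 _ _ hp'')))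

/-- `[[P,F],F] ≤ [[P,P],P] + [[Q,P],F]`. -/
theorem gP_le {P Q : LieIdeal k F} (h : ∀ x : F, ∃ p ∈ P, ∃ q ∈ Q, p + q = x) :
    ∀ t ∈ gI P, t ∈ tI P P P ⊔ tI Q P ⊤ := by
  refine tri_le P ⊤ ⊤ (tI P P P ⊔ tI Q P ⊤).toSubmodule ?_
  intro x hx y _ z _
  obtain ⟨p', hp', q', hq', rfl⟩ := h y
  obtain ⟨p'', hp'', q'', hq'', rfl⟩ := h z
  have e : ⁅⁅x, p' + q'⁆, p'' + q''⁆ = ⁅⁅x, p'⁆, p''⁆ +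
      (⁅⁅q'', p'⁆, x⁆ - ⁅⁅q'', x⁆, p'⁆ - ⁅⁅q', x⁆, p'' + q''⁆) := by
    have j : ⁅⁅x, p'⁆, q''⁆ = ⁅⁅q'', p'⁆, x⁆ - ⁅⁅q'', x⁆, p'⁆ := by
      rw [← lie_skew, leibniz_lie, ← lie_skew x]; abel
    have j2 : ⁅x, q'⁆ = -⁅q', x⁆ := (lie_skew _ _).symm
    rw [lie_add x, add_lie, lie_add ⁅x, p'⁆, j, j2, neg_lie]; abel
  rw [e]
  exact add_mem (LieSubmodule.mem_sup_left (mem_tI hx hp' hp''))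
    (LieSubmodule.mem_sup_right (sub_mem (sub_mem (mem_tI hq'' hp' (LieSubmodule.mem_top _))
      (mem_tI hq'' hx (LieSubmodule.mem_top _))) (mem_tI hq' hx (LieSubmodule.mem_top _))))

/-- elements of `Q` in `P + [F,F]` are in `R + [Q,Q]`. -/
theorem mem_R_QQ {P Q : LieIdeal k F} (h : ∀ x : F, ∃ p ∈ P, ∃ q ∈ Q, p + q = x) {q : F}
    (hq : q ∈ Q) (hq' : q ∈ P ⊔ (⁅(⊤ : LieIdeal k F), (⊤ : LieIdeal k F)⁆ : LieIdeal k F)) :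
    q ∈ (P ⊓ Q) ⊔ (⁅Q, Q⁆ : LieIdeal k F) := by
  have h1 : (⁅(⊤ : LieIdeal k F), (⊤ : LieIdeal k F)⁆ : LieIdeal k F) ≤ P ⊔ ⁅Q, Q⁆ := by
    rw [LieSubmodule.lie_le_iff]
    intro x _ y _
    obtain ⟨p, hp, q, hq, rfl⟩ := h x
    obtain ⟨p', hp', q', hq', rfl⟩ := h y
    have e : ⁅p + q, p' + q'⁆ = (⁅p, p' + q'⁆ + ⁅q, p'⁆) + ⁅q, q'⁆ := by
      simp only [add_lie, lie_add]; abel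
    rw [e]
    exact add_mem (LieSubmodule.mem_sup_left
      (add_mem (lie_mem_left k F P _ _ hp) (lie_mem_right k F P _ _ hp')))
      (LieSubmodule.mem_sup_right (LieSubmodule.lie_mem_lie hq hq'))
  have h2 : q ∈ P ⊔ (⁅Q, Q⁆ : LieIdeal k F) := (sup_le le_sup_left h1) hq'
  obtain ⟨r, hr, t, ht, rfl⟩ := (LieSubmodule.mem_sup _ _ _).1 h2
  have ht' : t ∈ Q := LieSubmodule.lie_le_right _ _ ht
  have hr' : r ∈ Q := by simpa using sub_mem hq ht'
  exact add_mem (LieSubmodule.mem_sup_left ⟨hr, hr'⟩) (LieSubmodule.mem_sup_right ht)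

theorem lie_PQ {P Q : LieIdeal k F} {q p : F} (hq : q ∈ Q) (hp : p ∈ P) : ⁅q, p⁆ ∈ P ⊓ Q :=
  ⟨lie_mem_right k F P _ _ hp, lie_mem_left k F Q _ _ hq⟩

theorem small_a {P Q : LieIdeal k F} {q p : F}
    (hq : q ∈ (P ⊓ Q) ⊔ (⁅Q, Q⁆ : LieIdeal k F)) (hp : p ∈ P) :
    ⁅q, p⁆ ∈ (⁅P ⊓ Q, (⊤ : LieIdeal k F)⁆ : LieIdeal k F) := by
  obtain ⟨r, hr, t, ht, rfl⟩ := (LieSubmodule.mem_sup _ _ _).1 hq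
  rw [add_lie]
  refine add_mem (gI_b1 _ hr) ?_
  rw [← LieSubmodule.mem_toSubmodule, LieSubmodule.lieIdeal_oper_eq_linear_span'] at ht
  refine Submodule.span_induction
    (p := fun t _ => ⁅t, p⁆ ∈ (⁅P ⊓ Q, (⊤ : LieIdeal k F)⁆ : LieIdeal k F)) ?_ ?_ ?_ ?_ ht
  · rintro _ ⟨x, hx, y, hy, rfl⟩
    rw [lie_lie]
    exact sub_mem (gI_b2 _ (lie_PQ hy hp)) (gI_b2 _ (lie_PQ hx hp))
  · simp
  · intro a b _ _ ha hb
    rw [add_lie]; exact add_mem ha hb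
  · intro c a _ ha
    rw [smul_lie]; exact SMulMemClass.smul_mem c ha

theorem small_c {R I : LieIdeal k F} {x y z : F} (hr : ⁅x, y⁆ ∈ R)
    (hz : z ∈ R ⊔ (⁅I, I⁆ : LieIdeal k F)) : ⁅⁅x, y⁆, z⁆ ∈ gI R := by
  obtain ⟨r, hr', t, ht, rfl⟩ := (LieSubmodule.mem_sup _ _ _).1 hz
  rw [lie_add]
  refine add_mem (gI_3 _ _ hr') ?_
  rw [← LieSubmodule.mem_toSubmodule, LieSubmodule.lieIdeal_oper_eq_linear_span'] at ht
  refine Submodule.span_induction (p := fun t _ => ⁅⁅x, y⁆, t⁆ ∈ gI R) ?_ ?_ ?_ ?_ ht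
  · rintro _ ⟨a, _, b, _, rfl⟩
    exact gI_r _ _ hr
  · simp
  · intro a b _ _ ha hb
    rw [lie_add]; exact add_mem ha hb
  · intro c a _ ha
    rw [lie_smul]; exact SMulMemClass.smul_mem c ha
end

theorem tri_sum {F ι κ : Type*} [LieRing F] [LieAlgebra k F] [Fintype ι] [Fintype κ]
    (S : Submodule k F) (a : ι → F) (b : κ → F) (x0 y0 z : F) (c : ι → k) (d : κ → k)
    (h : ∀ i j, ⁅⁅a i, b j⁆, z⁆ ∈ S)
    (h1 : ⁅⁅x0, ∑ j, d j • b j + y0⁆, z⁆ ∈ S) (h2 : ⁅⁅∑ i, c i • a i, y0⁆, z⁆ ∈ S) :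
    ⁅⁅∑ i, c i • a i + x0, ∑ j, d j • b j + y0⁆, z⁆ ∈ S := by
  rw [add_lie _ x0, add_lie]
  refine S.add_mem ?_ h1
  rw [lie_add, add_lie]
  refine S.add_mem ?_ h2
  simp only [sum_lie, lie_sum, smul_lie, lie_smul, Finset.smul_sum]
  exact Submodule.sum_mem _ fun i _ => Submodule.sum_mem _ fun j _ =>
    S.smul_mem _ (S.smul_mem _ (h _ _))

theorem sgl1 {I J K M : Type*} [DecidableEq I] [DecidableEq J] [DecidableEq K]
    [DecidableEq ((I × J × K) ⊕ M)] (a a' : I) (b b' : J) (c c' : K) :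
    (Pi.single (Sum.inl (a, b, c)) 1 : ((I × J × K) ⊕ M) → k) (Sum.inl (a', b', c')) =
      (if a = a' then 1 else 0) * (if b = b' then 1 else 0) * (if c = c' then 1 else 0) := by
  by_cases h1 : a = a' <;> by_cases h2 : b = b' <;> by_cases h3 : c = c' <;>
    simp [h1, h2, h3, Ne.symm]

theorem sgl2 {I J K M : Type*} [DecidableEq I] [DecidableEq J] [DecidableEq K]
    [DecidableEq (M ⊕ (I × J × K))] (a a' : I) (b b' : J) (c c' : K) :
    (Pi.single (Sum.inr (a, b, c)) 1 : (M ⊕ (I × J × K)) → k) (Sum.inr (a', b', c')) =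
      (if a = a' then 1 else 0) * (if b = b' then 1 else 0) * (if c = c' then 1 else 0) := by
  by_cases h1 : a = a' <;> by_cases h2 : b = b' <;> by_cases h3 : c = c' <;>
    simp [h1, h2, h3, Ne.symm]

theorem sum_sgl {ι : Type*} [Fintype ι] [DecidableEq ι] (c : ι → k) :
    ∑ i, c i • (Pi.single i 1 : ι → k) = c := by
  funext i
  simp [Finset.sum_apply, Pi.single_apply]

theorem core {X V W : Type u} (P Q : LieIdeal k (FreeLieAlgebra k X))
    (hPQ : ∀ x, ∃ p ∈ P, ∃ q ∈ Q, p + q = x)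
    (e : FreeLieAlgebra k X →ₗ⁅k⁆ FreeLieAlgebra k X)
    (he1 : ∀ x ∈ Q, e x ∈ P ⊓ Q) (he2 : ∀ x ∈ P, e x - x ∈ P ⊓ Q)
    [AddCommGroup V] [Module k V] [FiniteDimensional k V]
    [AddCommGroup W] [Module k W] [FiniteDimensional k W]
    (α : FreeLieAlgebra k X →ₗ[k] V) (hα : Function.Surjective α)
    (hαk : ∀ x, α x = 0 ↔ x ∈ P ⊔ (⁅(⊤ : LieIdeal k (FreeLieAlgebra k X)),
      (⊤ : LieIdeal k (FreeLieAlgebra k X))⁆ : LieIdeal k (FreeLieAlgebra k X)))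
    (β : FreeLieAlgebra k X →ₗ[k] W) (hβ : Function.Surjective β)
    (hβk : ∀ x, β x = 0 ↔ x ∈ Q ⊔ (⁅(⊤ : LieIdeal k (FreeLieAlgebra k X)),
      (⊤ : LieIdeal k (FreeLieAlgebra k X))⁆ : LieIdeal k (FreeLieAlgebra k X))) :
    subQuotRank k ((P ⊓ Q) ⊓ gI ⊤).toSubmodule (gI (P ⊓ Q)).toSubmodule =
      subQuotRank k (P ⊓ gI ⊤).toSubmodule (gI P).toSubmodule +
      subQuotRank k (Q ⊓ gI ⊤).toSubmodule (gI Q).toSubmodule +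
      ((finrank k V ^ 2 * finrank k W + finrank k W ^ 2 * finrank k V : ℕ) : Cardinal.{u}) := by
  classical
  have hQP : ∀ x, ∃ p ∈ Q, ∃ q ∈ P, p + q = x := fun x => by
    obtain ⟨p, hp, q, hq, rfl⟩ := hPQ x
    exact ⟨q, hq, p, hp, add_comm _ _⟩
  have hαP : ∀ x ∈ P, α x = 0 := fun x hx => (hαk x).2 (LieSubmodule.mem_sup_left hx)
  have hβQ : ∀ x ∈ Q, β x = 0 := fun x hx => (hβk x).2 (LieSubmodule.mem_sup_left hx)
  have hαl : ∀ x y : FreeLieAlgebra k X, α ⁅x, y⁆ = 0 := fun x y => (hαk _).2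
    (LieSubmodule.mem_sup_right (LieSubmodule.lie_mem_lie (LieSubmodule.mem_top _)
      (LieSubmodule.mem_top _)))
  have hβl : ∀ x y : FreeLieAlgebra k X, β ⁅x, y⁆ = 0 := fun x y => (hβk _).2
    (LieSubmodule.mem_sup_right (LieSubmodule.lie_mem_lie (LieSubmodule.mem_top _)
      (LieSubmodule.mem_top _)))
  let bV := Module.finBasis k V
  let bW := Module.finBasis k W
  have hq : ∀ i, ∃ q ∈ Q, α q = bV i := fun i => by
    obtain ⟨x, hx⟩ := hα (bV i)
    obtain ⟨p, hp, q, hq, rfl⟩ := hPQ x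
    exact ⟨q, hq, by rw [← hx, map_add, hαP p hp, zero_add]⟩
  have hp : ∀ i, ∃ p ∈ P, β p = bW i := fun i => by
    obtain ⟨x, hx⟩ := hβ (bW i)
    obtain ⟨p, hp, q, hq, rfl⟩ := hPQ x
    exact ⟨p, hp, by rw [← hx, map_add, hβQ q hq, add_zero]⟩
  choose q hqQ hqα using hq
  choose p hpP hpβ using hp
  let fv : Fin (finrank k V) → FreeLieAlgebra k X →ₗ[k] k := fun i => bV.coord i ∘ₗ α
  let fw : Fin (finrank k W) → FreeLieAlgebra k X →ₗ[k] k := fun i => bW.coord i ∘ₗ β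
  have fvl : ∀ i, ∀ x y : FreeLieAlgebra k X, fv i ⁅x, y⁆ = 0 := fun i x y => by
    simp [fv, hαl]
  have fwl : ∀ i, ∀ x y : FreeLieAlgebra k X, fw i ⁅x, y⁆ = 0 := fun i x y => by
    simp [fw, hβl]
  have fvP : ∀ i, ∀ x ∈ P, fv i x = 0 := fun i x hx => by simp [fv, hαP x hx]
  have fwQ : ∀ i, ∀ x ∈ Q, fw i x = 0 := fun i x hx => by simp [fw, hβQ x hx]
  have fvq : ∀ i j, fv i (q j) = if j = i then 1 else 0 := fun i j => by
    simp [fv, hqα, Finsupp.single_apply]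
  have fwp : ∀ i j, fw i (p j) = if j = i then 1 else 0 := fun i j => by
    simp [fw, hpβ, Finsupp.single_apply]
  choose Φ1 hΦ1 using fun s : Fin (finrank k V) × Fin (finrank k W) × Fin (finrank k V) =>
    exists_triple (fw s.2.1) (fv s.1) (fv s.2.2) (fwl _) (fvl _) (fvl _)
  choose Φ2 hΦ2 using fun s : Fin (finrank k V) × Fin (finrank k W) × Fin (finrank k W) =>
    exists_triple (fv s.1) (fw s.2.1) (fw s.2.2) (fvl _) (fwl _) (fwl _)
  let ι := (Fin (finrank k V) × Fin (finrank k W) × Fin (finrank k V)) ⊕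
    (Fin (finrank k V) × Fin (finrank k W) × Fin (finrank k W))
  let Φ : FreeLieAlgebra k X →ₗ[k] (ι → k) := LinearMap.pi (Sum.elim (fun s => - Φ1 s) Φ2)
  let E : ι → FreeLieAlgebra k X := Sum.elim (fun s => ⁅⁅q s.1, p s.2.1⁆, q s.2.2⁆)
    (fun s => ⁅⁅q s.1, p s.2.1⁆, p s.2.2⁆)
  have hΦE : ∀ s, Φ (E s) = Pi.single s 1 := by
    intro s
    funext t
    rcases s with ⟨a, b, c⟩ | ⟨a, b, c⟩ <;> rcases t with ⟨a', b', c'⟩ | ⟨a', b', c'⟩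
    · change -Φ1 (a', b', c') ⁅⁅q a, p b⁆, q c⁆ = _
      rw [hΦ1, fwQ _ _ (hqQ _), fvP _ _ (hpP _), fwQ _ _ (hqQ _), fwp, fvq, fvq]
      refine Eq.trans ?_ (sgl1 a a' b b' c c').symm
      ring
    · change Φ2 (a', b', c') ⁅⁅q a, p b⁆, q c⁆ = _
      rw [hΦ2, fwQ _ _ (hqQ _), fvP _ _ (hpP _), fwQ _ _ (hqQ c), fwQ _ _ (hqQ a)]
      rw [Pi.single_eq_of_ne (by exact Sum.inr_ne_inl)]
      ring
    · change -Φ1 (a', b', c') ⁅⁅q a, p b⁆, p c⁆ = _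
      rw [hΦ1, fwQ _ _ (hqQ _), fvP _ _ (hpP _), fvP _ _ (hpP _), fvP _ _ (hpP _)]
      rw [Pi.single_eq_of_ne (by exact Sum.inl_ne_inr)]
      ring
    · change Φ2 (a', b', c') ⁅⁅q a, p b⁆, p c⁆ = _
      rw [hΦ2, fwQ _ _ (hqQ _), fvP _ _ (hpP _), fvP _ _ (hpP _), fwp, fwp, fvq]
      refine Eq.trans ?_ (sgl2 a a' b b' c c').symm
      ring
  have hΦT : ∀ t ∈ gI (P ⊓ Q), Φ t = 0 := by
    refine tri_le (P ⊓ Q) ⊤ ⊤ (LinearMap.ker Φ) ?_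
    intro x hx y _ z _
    rw [LinearMap.mem_ker]
    funext t
    rcases t with t | t
    · change -Φ1 t ⁅⁅x, y⁆, z⁆ = 0
      rw [hΦ1, fwQ _ _ hx.2, fvP _ _ hx.1, fvP _ _ hx.1]
      ring
    · change Φ2 t ⁅⁅x, y⁆, z⁆ = 0
      rw [hΦ2, fwQ _ _ hx.2, fvP _ _ hx.1, fwQ _ _ hx.2]
      ring
  have hspan : ∀ t ∈ tI Q P ⊤, t ∈ Submodule.span k (Set.range E) ⊔ (gI (P ⊓ Q)).toSubmodule := by
    set Sp := Submodule.span k (Set.range E) ⊔ (gI (P ⊓ Q)).toSubmodule with hSp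
    have hT : ∀ t ∈ gI (P ⊓ Q), t ∈ Sp := fun t ht =>
      (le_sup_right : (gI (P ⊓ Q)).toSubmodule ≤ Sp) ht
    have hE : ∀ s, E s ∈ Sp := fun s =>
      (le_sup_left : Submodule.span k (Set.range E) ≤ Sp) (Submodule.subset_span ⟨s, rfl⟩)
    have dQ : ∀ x ∈ Q, ∃ x0 ∈ (P ⊓ Q) ⊔ (⁅Q, Q⁆ : LieIdeal k (FreeLieAlgebra k X)),
        x = ∑ i, fv i x • q i + x0 := by
      intro x hx
      refine ⟨x - ∑ i, fv i x • q i, ?_, by abel⟩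
      refine mem_R_QQ hPQ (sub_mem hx (sum_mem fun i _ => SMulMemClass.smul_mem _ (hqQ i))) ?_
      rw [← hαk, map_sub, map_sum]
      simp only [map_smul, hqα, fv, LinearMap.comp_apply, Basis.coord_apply, bV.sum_repr, sub_self]
    have dP : ∀ x ∈ P, ∃ x0 ∈ (P ⊓ Q) ⊔ (⁅P, P⁆ : LieIdeal k (FreeLieAlgebra k X)),
        x = ∑ i, fw i x • p i + x0 := by
      intro x hx
      refine ⟨x - ∑ i, fw i x • p i, ?_, by abel⟩
      rw [inf_comm]
      refine mem_R_QQ hQP (sub_mem hx (sum_mem fun i _ => SMulMemClass.smul_mem _ (hpP i))) ?_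
      rw [← hβk, map_sub, map_sum]
      simp only [map_smul, hpβ, fw, LinearMap.comp_apply, Basis.coord_apply, bW.sum_repr, sub_self]
    refine tri_le Q P ⊤ Sp ?_
    intro x hx y hy z _
    obtain ⟨x0, hx0, ex⟩ := dQ x hx
    obtain ⟨y0, hy0, ey⟩ := dP y hy
    have s1 : ⁅⁅x0, y⁆, z⁆ ∈ Sp := hT _ (gI_12 (small_a hx0 hy))
    have s2 : ⁅⁅x - x0, y0⁆, z⁆ ∈ Sp := by
      apply hT
      apply gI_12
      rw [← lie_skew]
      have hx' : x - x0 ∈ Q := sub_mem hx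
        ((sup_le inf_le_right (LieSubmodule.lie_le_right _ _) :
          (P ⊓ Q) ⊔ (⁅Q, Q⁆ : LieIdeal k (FreeLieAlgebra k X)) ≤ Q) hx0)
      rw [inf_comm] at hy0 ⊢
      exact neg_mem (small_a hy0 hx')
    have ex' : x - x0 = ∑ i, fv i x • q i := by rw [sub_eq_iff_eq_add]; exact ex
    rw [ex'] at s2
    rw [ey] at s1
    rw [ex, ey]
    refine tri_sum Sp q p x0 y0 z _ _ ?_ s1 s2
    intro i j
    obtain ⟨p', hp', q', hq', rfl⟩ := hPQ z
    obtain ⟨q0, hq0, eq⟩ := dQ q' hq'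
    obtain ⟨p0, hp0, ep⟩ := dP p' hp'
    rw [eq, ep]
    simp only [lie_add, lie_sum, lie_smul]
    refine add_mem (add_mem (sum_mem fun l _ => ?_) ?_) (add_mem (sum_mem fun l _ => ?_) ?_)
    · exact Sp.smul_mem _ (hE (Sum.inr (i, j, l)))
    · exact hT _ (small_c (lie_PQ (hqQ i) (hpP j)) hp0)
    · exact Sp.smul_mem _ (hE (Sum.inl (i, j, l)))
    · exact hT _ (small_c (lie_PQ (hqQ i) (hpP j)) hq0)
  have htQ : tI Q P ⊤ ≤ gI Q := by
    intro t ht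
    exact tri_le Q P ⊤ (gI Q).toSubmodule (fun x hx y _ z _ => gI_1 _ _ hx) t ht
  have hER : ∀ s, E s ∈ gI P ∧ E s ∈ gI Q := by
    rintro (s | s)
    · exact ⟨gI_2 _ _ (hpP _), gI_1 _ _ (hqQ _)⟩
    · exact ⟨gI_2 _ _ (hpP _), gI_1 _ _ (hqQ _)⟩
  -- the map
  let S := ((P ⊓ Q) ⊓ gI ⊤).toSubmodule
  let SA := (P ⊓ gI ⊤).toSubmodule
  let SB := (Q ⊓ gI ⊤).toSubmodule
  let iA : S →ₗ[k] SA := Submodule.inclusion (fun x hx => ⟨hx.1.1, hx.2⟩)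
  let iB : S →ₗ[k] SB := Submodule.inclusion (fun x hx => ⟨hx.1.2, hx.2⟩)
  let Ψ : S →ₗ[k] ((SA ⧸ (gI P).toSubmodule.comap SA.subtype) ×
      (SB ⧸ (gI Q).toSubmodule.comap SB.subtype)) × (ι → k) :=
    ((Submodule.mkQ _ ∘ₗ iA).prod (Submodule.mkQ _ ∘ₗ iB)).prod (Φ ∘ₗ S.subtype)
  have hker : LinearMap.ker Ψ = (gI (P ⊓ Q)).toSubmodule.comap S.subtype := by
    ext x
    have : x ∈ LinearMap.ker Ψ ↔ ((x : FreeLieAlgebra k X) ∈ gI P ∧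
        (x : FreeLieAlgebra k X) ∈ gI Q) ∧ Φ x = 0 := by
      rw [LinearMap.mem_ker, Prod.ext_iff, Prod.ext_iff]
      refine and_congr (and_congr ?_ ?_) Iff.rfl
      · exact Submodule.Quotient.mk_eq_zero _
      · exact Submodule.Quotient.mk_eq_zero _
    rw [this]
    change _ ↔ (x : FreeLieAlgebra k X) ∈ gI (P ⊓ Q)
    constructor
    · rintro ⟨⟨h1, h2⟩, h3⟩
      obtain ⟨t, ht, m, hm, hx⟩ := (LieSubmodule.mem_sup _ _ _).1 (gP_le hPQ _ h1)
      have ht2 : t ∈ gI Q := by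
        have := sub_mem h2 (htQ hm)
        rwa [← hx, add_sub_cancel_right] at this
      have ht3 : e t ∈ gI (P ⊓ Q) := map_gI e _ _ he1 t ht2
      have ht4 : e t - t ∈ gI (P ⊓ Q) := diff_gI e LieHom.id P (P ⊓ Q) he2 t ht
      have ht5 : t ∈ gI (P ⊓ Q) := by simpa using sub_mem ht3 ht4
      obtain ⟨s, hs, m', hm', rfl⟩ := Submodule.mem_sup.1 (hspan m hm)
      obtain ⟨c, rfl⟩ := (Submodule.mem_span_range_iff_exists_fun k).1 hs
      have h4 : Φ (∑ i, c i • E i) = 0 := by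
        rw [← hx, map_add, map_add, hΦT t ht5, hΦT m' hm', add_zero, zero_add] at h3
        exact h3
      have h5 : c = 0 := by
        rw [map_sum] at h4
        simp only [map_smul, hΦE] at h4
        exact (sum_sgl c).symm.trans h4
      rw [← hx, h5]
      simpa using add_mem ht5 hm'
    · intro h
      exact ⟨⟨gI_mono inf_le_left h, gI_mono inf_le_right h⟩, hΦT _ h⟩
  have hsurj : Function.Surjective Ψ := by
    rintro ⟨⟨a, b⟩, c⟩
    obtain ⟨⟨a, ha1, ha2⟩, rfl⟩ := Submodule.mkQ_surjective _ a
    obtain ⟨⟨b, hb1, hb2⟩, rfl⟩ := Submodule.mkQ_surjective _ b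
    have hQQQ : ∀ I : LieIdeal k (FreeLieAlgebra k X), tI I I I ≤ gI I := by
      intro I t ht
      exact tri_le I I I (gI I).toSubmodule (fun x hx y _ z _ => gI_1 _ _ hx) t ht
    obtain ⟨t, ht, g, hg, rfl⟩ := (LieSubmodule.mem_sup _ _ _).1 (top_le hPQ _ ha2)
    obtain ⟨t', ht', g', hg', rfl⟩ := (LieSubmodule.mem_sup _ _ _).1 (top_le hQP _ hb2)
    have ht := hQQQ _ ht
    have ht' := hQQQ _ ht'
    have tP : t ∈ P := by simpa using sub_mem ha1 (gI_le P hg)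
    have tQ : t' ∈ Q := by simpa using sub_mem hb1 (gI_le Q hg')
    let m := ∑ i, (c i - Φ (t + t') i) • E i
    have hmP : m ∈ gI P := sum_mem fun i _ => SMulMemClass.smul_mem _ (hER i).1
    have hmQ : m ∈ gI Q := sum_mem fun i _ => SMulMemClass.smul_mem _ (hER i).2
    refine ⟨⟨t + t' + m, ⟨⟨?_, ?_⟩, ?_⟩⟩, ?_⟩
    · exact add_mem (add_mem tP (gI_le _ ht')) (gI_le _ hmP)
    · exact add_mem (add_mem (gI_le _ ht) tQ) (gI_le _ hmQ)
    · exact add_mem (add_mem (gI_mono le_top ht) (gI_mono le_top ht')) (gI_mono le_top hmP)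
    · refine Prod.ext (Prod.ext ?_ ?_) ?_
      · refine (Submodule.Quotient.eq _).2 ?_
        change (t + t' + m) - (t + g) ∈ gI P
        have : (t + t' + m) - (t + g) = t' + m - g := by abel
        rw [this]
        exact sub_mem (add_mem ht' hmP) hg
      · refine (Submodule.Quotient.eq _).2 ?_
        change (t + t' + m) - (t' + g') ∈ gI Q
        have : (t + t' + m) - (t' + g') = t + m - g' := by abel
        rw [this]
        exact sub_mem (add_mem ht hmQ) hg'
      · change Φ (t + t' + m) = c
        rw [map_add, map_sum]
        simp only [map_smul, hΦE]
        have := sum_sgl (k := k) (fun i => c i - Φ (t + t') i)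
        refine (congrArg (fun v => Φ (t + t') + v) this).trans ?_
        funext i
        exact add_sub_cancel _ _
  have hr := (Ψ.quotKerEquivOfSurjective hsurj).rank_eq
  rw [hker] at hr
  unfold subQuotRank
  refine hr.trans ?_
  rw [rank_prod', rank_prod', rank_fun']
  congr 1
  simp only [ι, Fintype.card_sum, Fintype.card_prod, Fintype.card_fin]
  congr 1
  ring

theorem ab_ker {X L : Type u} [LieRing L] [LieAlgebra k L]
    (π : FreeLieAlgebra k X →ₗ⁅k⁆ L) (h : Function.Surjective π) (x : FreeLieAlgebra k X) :
    ((LieModule.lowerCentralSeries k L L 1).toSubmodule.mkQ ∘ₗ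
      (π : FreeLieAlgebra k X →ₗ[k] L)) x = 0 ↔
      x ∈ π.ker ⊔ (⁅(⊤ : LieIdeal k (FreeLieAlgebra k X)),
      (⊤ : LieIdeal k (FreeLieAlgebra k X))⁆ : LieIdeal k (FreeLieAlgebra k X)) := by
  have h0 : ((LieModule.lowerCentralSeries k L L 1).toSubmodule.mkQ ∘ₗ
      (π : FreeLieAlgebra k X →ₗ[k] L)) x = 0 ↔ π x ∈ LieModule.lowerCentralSeries k L L 1 :=
    Submodule.Quotient.mk_eq_zero _
  rw [h0, ← lcs_one_eq, ← LieIdeal.lowerCentralSeries_map_eq 1 h]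
  constructor
  · intro hx
    obtain ⟨y, hy⟩ := LieIdeal.mem_map_of_surjective h hx
    have : x - y ∈ π.ker := by rw [LieHom.mem_ker, map_sub, hy, sub_self]
    have := add_mem (LieSubmodule.mem_sup_left this) (LieSubmodule.mem_sup_right y.2)
    rwa [sub_add_cancel] at this
  · intro hx
    obtain ⟨r, hr, y, hy, rfl⟩ := (LieSubmodule.mem_sup _ _ _).1 hx
    rw [map_add, (LieHom.mem_ker).1 hr, zero_add]
    exact LieIdeal.mem_map hy

/-- first projection -/
def fstL (A B : Type u) [LieRing A] [LieAlgebra k A] [LieRing B] [LieAlgebra k B] :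
    (A × B) →ₗ⁅k⁆ A := { LinearMap.fst k A B with map_lie' := rfl }

/-- second projection -/
def sndL (A B : Type u) [LieRing A] [LieAlgebra k A] [LieRing B] [LieAlgebra k B] :
    (A × B) →ₗ⁅k⁆ B := { LinearMap.snd k A B with map_lie' := rfl }

/-- projection onto the second summand -/
def prB (A B : Type u) [LieRing A] [LieAlgebra k A] [LieRing B] [LieAlgebra k B] :
    (A × B) →ₗ⁅k⁆ (A × B) :=
  { LinearMap.inr k A B ∘ₗ LinearMap.snd k A B with
    map_lie' := by
      intro x y
      refine Prod.ext ?_ rfl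
      exact (lie_self (0 : A)).symm }

end Helpers

/-- For finite-dimensional Lie algebras `A` and `B`,
`dim M⁽²⁾(A ⊕ B) = dim M⁽²⁾(A) + dim M⁽²⁾(B) + (dim A/A²)²(dim B/B²) + (dim B/B²)²(dim A/A²)`. -/
theorem stmt_19 (k : Type u) [Field k] (A B : Type u) [LieRing A] [LieAlgebra k A]
    [LieRing B] [LieAlgebra k B] [FiniteDimensional k A] [FiniteDimensional k B]
    (X : Type u) (π : FreeLieAlgebra k X →ₗ⁅k⁆ (A × B)) (hπ : Function.Surjective π)
    (XA : Type u) (πA : FreeLieAlgebra k XA →ₗ⁅k⁆ A) (hπA : Function.Surjective πA)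
    (XB : Type u) (πB : FreeLieAlgebra k XB →ₗ⁅k⁆ B) (hπB : Function.Surjective πB) :
    m2Rank k π =
      m2Rank k πA + m2Rank k πB +
        ((Module.finrank k (A ⧸ LieModule.lowerCentralSeries k A A 1)) ^ 2 *
            Module.finrank k (B ⧸ LieModule.lowerCentralSeries k B B 1) +
          (Module.finrank k (B ⧸ LieModule.lowerCentralSeries k B B 1)) ^ 2 *
            Module.finrank k (A ⧸ LieModule.lowerCentralSeries k A A 1) : ℕ) := by
  let pA := (fstL (k := k) A B).comp π
  let pB := (sndL (k := k) A B).comp π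
  have sA : Function.Surjective pA := fun a => by
    obtain ⟨x, hx⟩ := hπ (a, 0)
    exact ⟨x, congrArg Prod.fst hx⟩
  have sB : Function.Surjective pB := fun b => by
    obtain ⟨x, hx⟩ := hπ (0, b)
    exact ⟨x, congrArg Prod.snd hx⟩
  rw [m2Rank_indep πA hπA pA sA, m2Rank_indep πB hπB pB sB, m2Rank_eq, m2Rank_eq, m2Rank_eq]
  have mA : ∀ x, x ∈ pA.ker ↔ (π x).1 = 0 := fun x => LieHom.mem_ker
  have mB : ∀ x, x ∈ pB.ker ↔ (π x).2 = 0 := fun x => LieHom.mem_ker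
  have hk : π.ker = pA.ker ⊓ pB.ker := by
    ext x
    rw [LieSubmodule.mem_inf, mA, mB, LieHom.mem_ker, Prod.ext_iff]
    rfl
  obtain ⟨e, he⟩ := exists_lift ((prB (k := k) A B).comp π) π hπ
  have he1 : ∀ x, (π (e x)).1 = 0 := fun x => congrArg Prod.fst (he x)
  have he2 : ∀ x, (π (e x)).2 = (π x).2 := fun x => by
    have := congrArg Prod.snd (he x)
    exact this
  rw [hk]
  refine core pA.ker pB.ker ?_ e ?_ ?_
    ((LieModule.lowerCentralSeries k A A 1).toSubmodule.mkQ ∘ₗ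
      (pA : FreeLieAlgebra k X →ₗ[k] A)) ?_ (ab_ker pA sA)
    ((LieModule.lowerCentralSeries k B B 1).toSubmodule.mkQ ∘ₗ
      (pB : FreeLieAlgebra k X →ₗ[k] B)) ?_ (ab_ker pB sB)
  · intro x
    refine ⟨e x, (mA _).2 (he1 x), x - e x, (mB _).2 ?_, by abel⟩
    rw [map_sub, Prod.snd_sub, he2, sub_self]
  · intro x hx
    exact ⟨(mA _).2 (he1 x), (mB _).2 ((he2 x).trans ((mB x).1 hx))⟩
  · intro x hx
    refine ⟨(mA _).2 ?_, (mB _).2 ?_⟩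
    · rw [map_sub, Prod.fst_sub, he1, (mA x).1 hx, sub_self]
    · rw [map_sub, Prod.snd_sub, he2, sub_self]
  · exact (Submodule.mkQ_surjective _).comp sA
  · exact (Submodule.mkQ_surjective _).comp sB
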